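/- arXiv:2305.08270 — 2 statements merged into one kernel-verified Lean document; each statement's English description precedes it below -/
import Mathlib

section
/- Let L ⊆ K^N × K^N be a Lagrange structure (L = L*) with l = dim ker L. Then there exist an injective matrix G ∈ K^{N×l} and a Hermitian matrix M = M* ∈ K^{N×N} with M(ker G*) ⊆ ker G* such that L = {(Me - Gλ, e) : G*e = 0, λ ∈ K^l}. -/
open scoped BigOperators
open Matrix

noncomputable section

variable {𝕜 : Type*} [RCLike 𝕜]

/-- The pairing ⟨x,y⟩ = y*x = ∑ conj(y i) * x i. -/
def herm {ι : Type*} [Fintype ι] (x y : ι → 𝕜) : 𝕜 :=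
  ∑ i, (starRingEnd 𝕜) (y i) * x i

/-- The adjoint relation A* = {(e',f') : ⟨f',e⟩ = ⟨e',f⟩ for all (e,f) ∈ A}. -/
def adjRel {ι : Type*} [Fintype ι] (A : Submodule 𝕜 ((ι → 𝕜) × (ι → 𝕜))) :
    Submodule 𝕜 ((ι → 𝕜) × (ι → 𝕜)) where
  carrier := {p | ∀ q ∈ A, herm p.2 q.1 = herm p.1 q.2}
  add_mem' := by
    intro a b ha hb q hq
    have h1 := ha q hq
    have h2 := hb q hq
    simp only [herm, Prod.snd_add, Prod.fst_add, Pi.add_apply, mul_add,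
      Finset.sum_add_distrib] at *
    rw [h1, h2]
  zero_mem' := by
    intro q hq
    simp [herm]
  smul_mem' := by
    intro c p hp q hq
    have h := hp q hq
    simp only [herm, Prod.smul_snd, Prod.smul_fst, Pi.smul_apply, smul_eq_mul] at *
    calc ∑ i, (starRingEnd 𝕜) (q.1 i) * (c * p.2 i)
        = c * ∑ i, (starRingEnd 𝕜) (q.1 i) * p.2 i := by
          rw [Finset.mul_sum]; congr 1; ext i; ring
      _ = c * ∑ i, (starRingEnd 𝕜) (q.2 i) * p.1 i := by rw [h]
      _ = ∑ i, (starRingEnd 𝕜) (q.2 i) * (c * p.1 i) := by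
          rw [Finset.mul_sum]; congr 1; ext i; ring

/-- The relation −A* = {(e',−f') : (e',f') ∈ A*}. -/
def negAdj {ι : Type*} [Fintype ι] (A : Submodule 𝕜 ((ι → 𝕜) × (ι → 𝕜))) :
    Submodule 𝕜 ((ι → 𝕜) × (ι → 𝕜)) :=
  (adjRel A).map ((LinearMap.fst 𝕜 (ι → 𝕜) (ι → 𝕜)).prod (-(LinearMap.snd 𝕜 (ι → 𝕜) (ι → 𝕜))))

/-- Kernel representation ker [K, L] = {(f,e) : Kf + Le = 0}. -/
def kerRep {p n : ℕ} (K L : Matrix (Fin p) (Fin n) 𝕜) :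
    Submodule 𝕜 ((Fin n → 𝕜) × (Fin n → 𝕜)) :=
  LinearMap.ker (K.mulVecLin.comp (LinearMap.fst 𝕜 (Fin n → 𝕜) (Fin n → 𝕜)) +
    L.mulVecLin.comp (LinearMap.snd 𝕜 (Fin n → 𝕜) (Fin n → 𝕜)))

/-- Image representation ran [F; G] = {(Fx, Gx) : x}. -/
def ranRep {n m : ℕ} (F G : Matrix (Fin n) (Fin m) 𝕜) :
    Submodule 𝕜 ((Fin n → 𝕜) × (Fin n → 𝕜)) :=
  LinearMap.range (F.mulVecLin.prod G.mulVecLin)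

/-- The kernel of a linear relation: ker A = {f : (f,0) ∈ A}. -/
def kerRel {ι : Type*} [Fintype ι] (A : Submodule 𝕜 ((ι → 𝕜) × (ι → 𝕜))) :
    Submodule 𝕜 (ι → 𝕜) :=
  A.comap (LinearMap.prod LinearMap.id 0)

end

section

variable {𝕜 : Type*} [RCLike 𝕜] {ι : Type*}

/-- The range of a linear relation, as a subspace of Euclidean space. -/
def ranRel (A : Submodule 𝕜 ((ι → 𝕜) × (ι → 𝕜))) : Submodule 𝕜 (EuclideanSpace 𝕜 ι) :=
  (A.map (LinearMap.snd 𝕜 (ι → 𝕜) (ι → 𝕜))).comap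
    (WithLp.linearEquiv 2 𝕜 (ι → 𝕜)).toLinearMap

theorem mem_ranRel_iff (A : Submodule 𝕜 ((ι → 𝕜) × (ι → 𝕜))) (x : EuclideanSpace 𝕜 ι) :
    x ∈ ranRel A ↔ ∃ f, (f, WithLp.ofLp x) ∈ A := by
  simp [ranRel]

variable [Fintype ι]

theorem herm_eq_inner (x y : ι → 𝕜) :
    herm x y = inner 𝕜 (WithLp.toLp 2 y) (WithLp.toLp 2 x) := by
  simp [herm, PiLp.inner_apply, mul_comm]

theorem herm_mulVec {κ : Type*} [Fintype κ] (A : Matrix ι κ 𝕜) (x : ι → 𝕜) (v : κ → 𝕜) :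
    herm x (A *ᵥ v) = herm (Aᴴ *ᵥ x) v := by
  change star (A *ᵥ v) ⬝ᵥ x = star v ⬝ᵥ (Aᴴ *ᵥ x)
  rw [star_mulVec, dotProduct_mulVec]

theorem mem_kerRel_iff (A : Submodule 𝕜 ((ι → 𝕜) × (ι → 𝕜))) (f : ι → 𝕜) :
    f ∈ kerRel A ↔ (f, 0) ∈ A := Iff.rfl

/-- The kernel of the adjoint relation is the orthogonal complement of the range. -/
theorem mem_kerRel_adjRel_iff (A : Submodule 𝕜 ((ι → 𝕜) × (ι → 𝕜))) (f : ι → 𝕜) :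
    f ∈ kerRel (adjRel A) ↔ WithLp.toLp 2 f ∈ (ranRel A)ᗮ := by
  rw [mem_kerRel_iff, Submodule.mem_orthogonal]
  constructor
  · intro h x hx
    obtain ⟨g, hg⟩ := (mem_ranRel_iff A x).1 hx
    have h' : herm 0 g = herm f (WithLp.ofLp x) := h _ hg
    rw [herm_eq_inner, herm_eq_inner] at h'
    simpa using h'.symm
  · intro h q hq
    have h' := h (WithLp.toLp 2 q.2) ((mem_ranRel_iff A _).2 ⟨q.1, hq⟩)
    rw [herm_eq_inner, herm_eq_inner, h']
    simp

/-- Every linear relation contains the graph of a linear map over its range. -/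
theorem exists_linear_selection {V W : Type*} [AddCommGroup V] [Module 𝕜 V]
    [AddCommGroup W] [Module 𝕜 W] (A : Submodule 𝕜 (V × W)) :
    ∃ s : W →ₗ[𝕜] V, ∀ p ∈ A, (s p.2, p.2) ∈ A := by
  let φ : A →ₗ[𝕜] W := LinearMap.snd 𝕜 V W ∘ₗ A.subtype
  obtain ⟨g, hg⟩ := φ.rangeRestrict.exists_rightInverse_of_surjective φ.range_rangeRestrict
  obtain ⟨t, ht⟩ := LinearMap.exists_extend g
  refine ⟨LinearMap.fst 𝕜 V W ∘ₗ A.subtype ∘ₗ t, fun p hp => ?_⟩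
  let y : LinearMap.range φ := φ.rangeRestrict ⟨p, hp⟩
  have hty : t p.2 = g y := LinearMap.congr_fun ht y
  have hgy : (g y : V × W).2 = p.2 := congrArg Subtype.val (LinearMap.congr_fun hg y)
  have hmem := (g y).2
  change ((t p.2 : V × W).1, p.2) ∈ A
  rw [hty, ← hgy]
  exact hmem

/-- A Lagrange structure contains the graph of a Hermitian matrix over its range, and this matrix
maps the whole space into the range. -/
theorem exists_hermitian_selection [DecidableEq ι] (L : Submodule 𝕜 ((ι → 𝕜) × (ι → 𝕜)))
    (hL : L = adjRel L) :
    ∃ M : Matrix ι ι 𝕜, Mᴴ = M ∧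
      (∀ e, WithLp.toLp 2 (M *ᵥ e) ∈ ranRel L) ∧
      ∀ e, WithLp.toLp 2 e ∈ ranRel L → (M *ᵥ e, e) ∈ L := by
  obtain ⟨s, hs⟩ := exists_linear_selection L
  let P := (ranRel L).starProjection
  let ψ := WithLp.linearEquiv 2 𝕜 (ι → 𝕜)
  let S : EuclideanSpace 𝕜 ι →ₗ[𝕜] EuclideanSpace 𝕜 ι := ψ.symm.toLinearMap ∘ₗ s ∘ₗ ψ.toLinearMap
  let T : EuclideanSpace 𝕜 ι →ₗ[𝕜] EuclideanSpace 𝕜 ι :=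
    P.toLinearMap ∘ₗ S ∘ₗ P.toLinearMap
  have hS : ∀ x ∈ ranRel L, (WithLp.ofLp (S x), WithLp.ofLp x) ∈ L := by
    intro x hx
    obtain ⟨f, hf⟩ := (mem_ranRel_iff L x).1 hx
    exact hs _ hf
  have hP : ∀ x, P x ∈ ranRel L := fun x => (ranRel L).starProjection_apply_mem x
  have hT : T.IsSymmetric := by
    intro x y
    change inner 𝕜 (P (S (P x))) y = inner 𝕜 x (P (S (P y)))
    rw [Submodule.inner_starProjection_left_eq_right,
      ← Submodule.inner_starProjection_left_eq_right (ranRel L) x]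
    have hy := hS _ (hP y)
    rw [hL] at hy
    have h := hy _ (hS _ (hP x))
    rw [herm_eq_inner, herm_eq_inner] at h
    exact h
  have hM : ∀ e, WithLp.toLp 2 (Matrix.toEuclideanLin.symm T *ᵥ e) = T (WithLp.toLp 2 e) := by
    intro e
    conv_rhs => rw [← Matrix.toEuclideanLin.apply_symm_apply T]
    rfl
  refine ⟨Matrix.toEuclideanLin.symm T, ?_, fun e => ?_, fun e he => ?_⟩
  · apply Matrix.isSymmetric_toEuclideanLin_iff.1
    rwa [LinearEquiv.apply_symm_apply]
  · rw [hM]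
    exact hP _
  · have hPe : P (WithLp.toLp 2 e) = WithLp.toLp 2 e :=
      Submodule.starProjection_eq_self_iff.2 he
    have hTe : T (WithLp.toLp 2 e) = P (S (WithLp.toLp 2 e)) :=
      congrArg (fun x => P (S x)) hPe
    have hker := (ranRel L).sub_starProjection_mem_orthogonal (S (WithLp.toLp 2 e))
    have hker' : WithLp.ofLp (S (WithLp.toLp 2 e)) - Matrix.toEuclideanLin.symm T *ᵥ e ∈
        kerRel L := by
      rw [hL, mem_kerRel_adjRel_iff, WithLp.toLp_sub, hM, hTe]
      exact hker
    have h := L.sub_mem (hS _ he) ((mem_kerRel_iff L _).1 hker')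
    simpa using h

end

/-- representation of a Lagrange structure L = {(Me - Gλ, e) : G*e = 0}. -/
theorem lagrange_representation {𝕜 : Type*} [RCLike 𝕜] {N : ℕ}
    (L : Submodule 𝕜 ((Fin N → 𝕜) × (Fin N → 𝕜)))
    (hL : L = adjRel L) :
    ∃ (G : Matrix (Fin N) (Fin (Module.finrank 𝕜 (kerRel L))) 𝕜)
      (M : Matrix (Fin N) (Fin N) 𝕜),
      (∀ v, G.mulVec v = 0 → v = 0) ∧
      Mᴴ = M ∧
      (∀ e : Fin N → 𝕜, Gᴴ.mulVec e = 0 → Gᴴ.mulVec (M.mulVec e) = 0) ∧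
      (∀ p : (Fin N → 𝕜) × (Fin N → 𝕜), p ∈ L ↔
        ∃ lam : Fin (Module.finrank 𝕜 (kerRel L)) → 𝕜,
          Gᴴ.mulVec p.2 = 0 ∧ p.1 = M.mulVec p.2 - G.mulVec lam) := by
  let b := Module.finBasis 𝕜 (kerRel L)
  let G : Matrix (Fin N) (Fin (Module.finrank 𝕜 (kerRel L))) 𝕜 :=
    Matrix.of fun i j => (b j : Fin N → 𝕜) i
  have hG : ∀ v, G *ᵥ v = ((b.equivFun.symm v : kerRel L) : Fin N → 𝕜) := by
    intro v
    ext i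
    simp [G, Matrix.mulVec, dotProduct, Module.Basis.equivFun_symm_apply, mul_comm]
  have hGker : ∀ u ∈ kerRel L, ∃ v, G *ᵥ v = u := fun u hu =>
    ⟨b.equivFun ⟨u, hu⟩, by rw [hG, LinearEquiv.symm_apply_apply]⟩
  have hGmem : ∀ v, (G *ᵥ v, 0) ∈ L := fun v => by
    rw [hG]
    exact (b.equivFun.symm v).2
  have hran : ∀ e : Fin N → 𝕜, Gᴴ *ᵥ e = 0 ↔ WithLp.toLp 2 e ∈ ranRel L := by
    intro e
    rw [← (ranRel L).orthogonal_orthogonal, Submodule.mem_orthogonal]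
    constructor
    · intro he u hu
      have hu' : WithLp.ofLp u ∈ kerRel L := by
        rw [hL, mem_kerRel_adjRel_iff]
        exact hu
      obtain ⟨v, hv⟩ := hGker _ hu'
      have h : herm e (WithLp.ofLp u) = 0 := by
        rw [← hv, herm_mulVec, he]
        simp [herm]
      rwa [herm_eq_inner] at h
    · intro h
      have hv : WithLp.toLp 2 (G *ᵥ (Gᴴ *ᵥ e)) ∈ (ranRel L)ᗮ := by
        rw [← mem_kerRel_adjRel_iff, ← hL]
        exact hGmem _
      have h0 := h _ hv
      rw [← herm_eq_inner, herm_mulVec, herm_eq_inner, inner_self_eq_zero] at h0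
      exact congrArg WithLp.ofLp h0
  obtain ⟨M, hM, hMran, hMmem⟩ := exists_hermitian_selection L hL
  refine ⟨G, M, fun v hv => ?_, hM, fun e _ => (hran _).2 (hMran e), fun p => ⟨fun hp => ?_, ?_⟩⟩
  · rw [hG] at hv
    exact b.equivFun.symm.map_eq_zero_iff.1 (Subtype.ext hv)
  · have hp2 : WithLp.toLp 2 p.2 ∈ ranRel L := (mem_ranRel_iff L _).2 ⟨p.1, hp⟩
    have hker : M *ᵥ p.2 - p.1 ∈ kerRel L := by
      have h := L.sub_mem (hMmem _ hp2) hp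
      rw [mem_kerRel_iff]
      simpa [Prod.sub_def] using h
    obtain ⟨v, hv⟩ := hGker _ hker
    exact ⟨v, (hran _).2 hp2, by rw [hv]; abel⟩
  · rintro ⟨v, hp2, hp1⟩
    have h := L.sub_mem (hMmem _ ((hran _).1 hp2)) (hGmem v)
    rw [Prod.mk_sub_mk, sub_zero, ← hp1] at h
    exact h
end

section
/- For any solution (u,z,y) of the pH descriptor DAE d/dt(Ez) = (J−R)Qz + (B−P)u, y = (B+P)*Qz + (S+N)u, the Hamiltonian H(z) = (1/2) z*Q*Ez satisfies H∘z ∈ C¹ and the power balance d/dt H(z(t)) = Re[u(t)* y(t)] − ‖W^{1/2} (Qz(t), u(t))‖², where W = [R, P; P*, S] ≥ 0 restricted as in the definition. -/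
open scoped BigOperators
open Matrix

open scoped ComplexOrder

section PowerBalance

variable {𝕜 : Type*} [RCLike 𝕜] {ι κ : Type*} [Fintype ι] [Fintype κ]

lemma herm_eq_star_dotProduct (x y : ι → 𝕜) : herm x y = star y ⬝ᵥ x := rfl

lemma herm_conj (x y : ι → 𝕜) : (starRingEnd 𝕜) (herm x y) = herm y x := by
  simp [herm, mul_comm]

lemma re_herm_comm (x y : ι → 𝕜) : RCLike.re (herm x y) = RCLike.re (herm y x) := by
  rw [← herm_conj, RCLike.conj_re]

lemma herm_add_left (x x' y : ι → 𝕜) : herm (x + x') y = herm x y + herm x' y := by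
  simp [herm_eq_star_dotProduct, dotProduct_add]

lemma herm_sub_left (x x' y : ι → 𝕜) : herm (x - x') y = herm x y - herm x' y := by
  simp [herm_eq_star_dotProduct, dotProduct_sub]

lemma herm_neg_left (x y : ι → 𝕜) : herm (-x) y = -herm x y := by
  simp [herm_eq_star_dotProduct]

lemma herm_add_right (x y y' : ι → 𝕜) : herm x (y + y') = herm x y + herm x y' := by
  simp [herm_eq_star_dotProduct, add_dotProduct]

lemma herm_smul_left (c : ℝ) (x y : ι → 𝕜) : herm (c • x) y = c • herm x y := by
  simp [herm_eq_star_dotProduct, dotProduct_smul]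

lemma herm_sumElim (x x' : ι → 𝕜) (y y' : κ → 𝕜) :
    herm (Sum.elim x y) (Sum.elim x' y') = herm x x' + herm y y' := by
  simp [herm]

lemma herm_mulVec_left (A : Matrix ι κ 𝕜) (x : κ → 𝕜) (y : ι → 𝕜) :
    herm (A *ᵥ x) y = herm x (Aᴴ *ᵥ y) := by
  rw [herm_eq_star_dotProduct, herm_eq_star_dotProduct, star_mulVec, conjTranspose_conjTranspose,
    dotProduct_mulVec]

lemma re_herm_conjTranspose_mulVec (A : Matrix ι κ 𝕜) (x : κ → 𝕜) (y : ι → 𝕜) :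
    RCLike.re (herm (Aᴴ *ᵥ y) x) = RCLike.re (herm (A *ᵥ x) y) := by
  rw [herm_mulVec_left A, re_herm_comm]

lemma re_herm_mulVec_self_of_skew {A : Matrix ι ι 𝕜} (hA : Aᴴ = -A) (x : ι → 𝕜) :
    RCLike.re (herm (A *ᵥ x) x) = 0 := by
  have h := re_herm_conjTranspose_mulVec A x x
  rw [hA, neg_mulVec, herm_neg_left, map_neg] at h
  linarith

lemma Filter.Tendsto.herm {α : Type*} {l : Filter α} {f g : α → ι → 𝕜} {a b : ι → 𝕜}
    (hf : Tendsto f l (nhds a)) (hg : Tendsto g l (nhds b)) :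
    Tendsto (fun s => _root_.herm (f s) (g s)) l (nhds (_root_.herm a b)) := by
  unfold _root_.herm
  exact tendsto_finsetSum _ fun i _ =>
    ((RCLike.continuous_conj.tendsto _).comp (hg.apply_nhds i)).mul (hf.apply_nhds i)

lemma ContinuousOn.herm {α : Type*} [TopologicalSpace α] {s : Set α} {f g : α → ι → 𝕜}
    (hf : ContinuousOn f s) (hg : ContinuousOn g s) :
    ContinuousOn (fun t => _root_.herm (f t) (g t)) s :=
  fun t ht => Filter.Tendsto.herm (hf t ht) (hg t ht)

lemma ContinuousOn.mulVec_const {l α : Type*} [TopologicalSpace α] {s : Set α} {f : α → κ → 𝕜}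
    (hf : ContinuousOn f s) (A : Matrix l κ 𝕜) : ContinuousOn (fun t => A *ᵥ f t) s :=
  (continuous_const.matrix_mulVec continuous_id).comp_continuousOn hf

/-- Difference of a Hermitian quadratic form at two points, factored. -/
lemma re_herm_mulVec_self_sub {E Q : Matrix ι κ 𝕜} (hEQ : Eᴴ * Q = Qᴴ * E) (x x' : κ → 𝕜) :
    RCLike.re (herm ((Qᴴ * E) *ᵥ x) x) - RCLike.re (herm ((Qᴴ * E) *ᵥ x') x') =
      RCLike.re (herm (E *ᵥ x - E *ᵥ x') (Q *ᵥ x + Q *ᵥ x')) := by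
  have key (a b : κ → 𝕜) :
      RCLike.re (herm ((Qᴴ * E) *ᵥ a) b) = RCLike.re (herm (E *ᵥ a) (Q *ᵥ b)) := by
    rw [← mulVec_mulVec, herm_mulVec_left, conjTranspose_conjTranspose]
  have hsymm : RCLike.re (herm (E *ᵥ x) (Q *ᵥ x')) = RCLike.re (herm (E *ᵥ x') (Q *ᵥ x)) := by
    rw [← key, ← hEQ, ← mulVec_mulVec, re_herm_conjTranspose_mulVec, re_herm_comm]
  rw [key, key, herm_sub_left, herm_add_right, herm_add_right]
  simp only [map_add, map_sub]
  linarith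

/-- The energy `½ z* Q* E z` is differentiable as soon as `E z` is differentiable and `z` is
continuous, with no differentiability of `z` itself. -/
lemma hasDerivWithinAt_energy {E Q : Matrix ι κ 𝕜} (hEQ : Eᴴ * Q = Qᴴ * E)
    {z : ℝ → κ → 𝕜} {w : ι → 𝕜} {s : Set ℝ} {t : ℝ} (hz : ContinuousWithinAt z s t)
    (hEz : HasDerivWithinAt (fun r => E *ᵥ z r) w s t) :
    HasDerivWithinAt (fun r => (1 / 2 : ℝ) * RCLike.re (herm ((Qᴴ * E) *ᵥ z r) (z r)))
      (RCLike.re (herm w (Q *ᵥ z t))) s t := by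
  rw [hasDerivWithinAt_iff_tendsto_slope] at hEz ⊢
  have hQz : Filter.Tendsto (fun r => Q *ᵥ z r + Q *ᵥ z t) (nhdsWithin t (s \ {t}))
      (nhds (Q *ᵥ z t + Q *ᵥ z t)) :=
    ((((continuous_const.matrix_mulVec continuous_id).tendsto (z t)).comp hz).mono_left
      (nhdsWithin_mono t Set.sdiff_subset)).add_const _
  have h := ((RCLike.continuous_re.tendsto _).comp (hEz.herm hQz)).const_mul (1 / 2 : ℝ)
  convert h using 1
  · ext r
    simp only [slope_def_module, Function.comp_apply, herm_smul_left, RCLike.smul_re,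
      ← re_herm_mulVec_self_sub hEQ, smul_eq_mul]
    ring
  · rw [herm_add_right, map_add]
    congr 1
    ring

end PowerBalance

/-- power balance for solutions of a pH descriptor system:
H ∘ z is C¹ on [0,∞) with d/dt H(z(t)) = Re[u* y] - ‖W^{1/2}(Qz, u)‖²,
where H(z) = (1/2) z* Q* E z and ‖W^{1/2}v‖² = v* [R P; P* S] v with v = (Qz, u). -/
theorem pH_descriptor_power_balance {𝕜 : Type*} [RCLike 𝕜] {n m : ℕ}
    (E J R Q : Matrix (Fin n) (Fin n) 𝕜) (B P : Matrix (Fin n) (Fin m) 𝕜)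
    (S N : Matrix (Fin m) (Fin m) 𝕜)
    (hEQ : Eᴴ * Q = Qᴴ * E) (hJ : Jᴴ = -J) (hN : Nᴴ = -N) (hR : Rᴴ = R) (hS : Sᴴ = S)
    (hW : (Matrix.fromBlocks (Qᴴ * R * Q) (Qᴴ * P) (Pᴴ * Q) S).PosSemidef)
    (z : ℝ → Fin n → 𝕜) (u y : ℝ → Fin m → 𝕜) (w : ℝ → Fin n → 𝕜)
    (hz : ContinuousOn z (Set.Ici 0)) (hu : ContinuousOn u (Set.Ici 0))
    (hy : ContinuousOn y (Set.Ici 0)) (hw : ContinuousOn w (Set.Ici 0))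
    (hEz : ∀ t ∈ Set.Ici (0:ℝ),
      HasDerivWithinAt (fun s => E.mulVec (z s)) (w t) (Set.Ici 0) t)
    (hDAE : ∀ t : ℝ, 0 ≤ t →
      w t = (J - R).mulVec (Q.mulVec (z t)) + (B - P).mulVec (u t))
    (hout : ∀ t : ℝ, 0 ≤ t →
      y t = (B + P)ᴴ.mulVec (Q.mulVec (z t)) + (S + N).mulVec (u t)) :
    ContinuousOn (fun t => RCLike.re (herm (y t) (u t)) -
        RCLike.re (herm ((Matrix.fromBlocks R P Pᴴ S).mulVec
            (Sum.elim (Q.mulVec (z t)) (u t)))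
          (Sum.elim (Q.mulVec (z t)) (u t)))) (Set.Ici 0)
    ∧ ∀ t : ℝ, 0 ≤ t →
      HasDerivWithinAt
        (fun s => (1 / 2 : ℝ) * RCLike.re (herm ((Qᴴ * E).mulVec (z s)) (z s)))
        (RCLike.re (herm (y t) (u t)) -
          RCLike.re (herm ((Matrix.fromBlocks R P Pᴴ S).mulVec
              (Sum.elim (Q.mulVec (z t)) (u t)))
            (Sum.elim (Q.mulVec (z t)) (u t))))
        (Set.Ici 0) t := by
  have hQz : ContinuousOn (fun t => Q *ᵥ z t) (Set.Ici 0) := hz.mulVec_const Q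
  simp only [fromBlocks_mulVec, Sum.elim_comp_inl, Sum.elim_comp_inr, herm_sumElim]
  refine ⟨?_, fun t ht => ?_⟩
  · exact (RCLike.continuous_re.comp_continuousOn (hy.herm hu)).sub
      (RCLike.continuous_re.comp_continuousOn
        ((((hQz.mulVec_const R).add (hu.mulVec_const P)).herm hQz).add
          (((hQz.mulVec_const Pᴴ).add (hu.mulVec_const S)).herm hu)))
  · convert hasDerivWithinAt_energy hEQ (hz t ht) (hEz t ht) using 1
    rw [hDAE t ht, hout t ht]
    simp only [conjTranspose_add, add_mulVec, sub_mulVec, herm_add_left, herm_sub_left, map_add,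
      map_sub, re_herm_conjTranspose_mulVec, re_herm_mulVec_self_of_skew hJ,
      re_herm_mulVec_self_of_skew hN]
    ring
end
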